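/- Quasi-uniformity of LGL grids: for every integer N ≥ 2 and every integer k with 1 ≤ k ≤ N−1, the lengths of consecutive LGL intervals satisfy 4/(7π²) ≤ |Δ_k^N|/|Δ_{k−1}^N| ≤ 7π²/4. -/

import Mathlib

/-- The Legendre polynomial of degree `N` via the Rodrigues formula. -/
noncomputable def legendrePoly (N : ℕ) : Polynomial ℝ :=
  Polynomial.C (1 / (2 ^ N * N.factorial : ℝ)) *
    Polynomial.derivative^[N] ((Polynomial.X ^ 2 - 1) ^ N)

/-- The polynomial `(1 - x²)·L_N'(x)` whose zeros are the LGL nodes of order `N`. -/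
noncomputable def lglPoly (N : ℕ) : Polynomial ℝ :=
  (1 - Polynomial.X ^ 2) * Polynomial.derivative (legendrePoly N)

/-- `ξ 0 < ξ 1 < ⋯ < ξ N` enumerates the Legendre-Gauss-Lobatto nodes of order `N`
in increasing order. -/
def IsLGLNodes (N : ℕ) (ξ : ℕ → ℝ) : Prop :=
  StrictMonoOn ξ (Set.Iic N) ∧ ξ 0 = -1 ∧ ξ N = 1 ∧
    (∀ k ≤ N, (lglPoly N).eval (ξ k) = 0) ∧
    (∀ x : ℝ, (lglPoly N).eval x = 0 → ∃ k ≤ N, ξ k = x)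

open Polynomial in
/-- The Leibniz rule applied to `(X² - 1) f' = 2 N X f` for `f = (X² - 1) ^ N`. -/
theorem iterate_derivative_X_sq_sub_one_pow (N n : ℕ) :
    (X ^ 2 - 1) * derivative^[n + 2] ((X ^ 2 - 1 : ℝ[X]) ^ N)
      + C (2 * (n + 1 - N) : ℝ) * X * derivative^[n + 1] ((X ^ 2 - 1) ^ N)
      + C ((n + 1) * n - 2 * N * (n + 1) : ℝ) * derivative^[n] ((X ^ 2 - 1) ^ N) = 0 := by
  induction n with
  | zero =>
    have h : (X ^ 2 - 1) * derivative ((X ^ 2 - 1 : ℝ[X]) ^ N)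
        = C (2 * N : ℝ) * X * (X ^ 2 - 1) ^ N := by
      cases N with
      | zero => simp
      | succ N =>
        simp only [derivative_pow_succ, derivative_sub, derivative_X, derivative_one]
        simp only [map_mul, map_add, map_natCast, map_ofNat, map_one, Nat.cast_add, Nat.cast_one]
        ring
    have hd := congrArg derivative h
    simp only [derivative_mul, derivative_sub, derivative_X_pow, derivative_one, derivative_C,
      derivative_X] at hd
    simp only [Function.iterate_succ', Function.iterate_zero, Function.comp, id]
    simp only [map_mul, map_add, map_sub, map_natCast, map_ofNat, map_one, Nat.cast_zero,
      map_zero, Nat.cast_ofNat] at hd ⊢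
    linear_combination hd
  | succ n ih =>
    have hd := congrArg derivative ih
    simp only [Function.iterate_succ', Function.comp] at hd ⊢
    simp only [derivative_add, derivative_mul, derivative_sub, derivative_X_pow, derivative_one,
      derivative_C, derivative_X, derivative_zero] at hd
    simp only [map_mul, map_add, map_sub, map_natCast, map_ofNat, map_one, Nat.cast_add,
      Nat.cast_one, Nat.cast_ofNat] at hd ⊢
    linear_combination hd

open Polynomial in
/-- Legendre's differential equation. -/
theorem legendrePoly_ode (N : ℕ) :
    (1 - X ^ 2) * derivative (derivative (legendrePoly N))
      - 2 * X * derivative (legendrePoly N) + C (N * (N + 1) : ℝ) * legendrePoly N = 0 := by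
  have h := iterate_derivative_X_sq_sub_one_pow N N
  simp only [legendrePoly, derivative_C_mul]
  simp only [Function.iterate_succ', Function.comp] at h
  simp only [map_mul, map_add, map_sub, map_natCast, map_ofNat, map_one] at h ⊢
  linear_combination (-C (1 / (2 ^ N * N.factorial : ℝ))) * h

open Polynomial in
/-- The polynomial `u = (1 - x²) L_N'` satisfies `(1 - x²) u'' = -N (N + 1) u`. -/
theorem lglPoly_ode (N : ℕ) :
    (1 - X ^ 2) * derivative (derivative (lglPoly N)) = -C (N * (N + 1) : ℝ) * lglPoly N := by
  have h1 : derivative (lglPoly N) = -C (N * (N + 1) : ℝ) * legendrePoly N := by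
    have h := legendrePoly_ode N
    simp only [lglPoly, derivative_mul, derivative_sub, derivative_X_pow, derivative_one]
    simp only [Nat.cast_ofNat, map_ofNat]
    linear_combination h
  rw [h1, lglPoly, ← map_neg, derivative_C_mul]
  ring

theorem natDegree_lglPoly_le {N : ℕ} (hN : 1 ≤ N) : (lglPoly N).natDegree ≤ N + 1 := by
  open Polynomial in
  have h0 : ((X ^ 2 - 1 : ℝ[X]) ^ N).natDegree ≤ N * 2 :=
    natDegree_pow_le_of_le N (by compute_degree)
  have h1 : (legendrePoly N).natDegree ≤ N := by
    refine (natDegree_C_mul_le _ _).trans ((natDegree_iterate_derivative _ _).trans ?_)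
    omega
  have h2 := natDegree_derivative_le (legendrePoly N)
  have h3 : (1 - X ^ 2 : ℝ[X]).natDegree ≤ 2 := by compute_degree
  have h4 := natDegree_mul_le_of_le h3 h2
  rw [lglPoly]
  omega

open Polynomial in
theorem sq_derivative_sub_X_sub_C_mul (m : ℝ[X]) (r x : ℝ) :
    ((derivative ((X - C r) * m)).eval x) ^ 2
      - ((X - C r) * m).eval x * (derivative (derivative ((X - C r) * m))).eval x
    = (m.eval x) ^ 2 + (x - r) ^ 2 *
      (((derivative m).eval x) ^ 2 - m.eval x * (derivative (derivative m)).eval x) := by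
  simp
  ring

open Polynomial in
/-- Laguerre's inequality for polynomials with only real roots. -/
theorem laguerre_inequality {ι : Type*} (c : ℝ) (ξ : ι → ℝ) (s : Finset ι) (x : ℝ) :
    0 ≤ ((derivative (C c * ∏ i ∈ s, (X - C (ξ i)))).eval x) ^ 2
      - (C c * ∏ i ∈ s, (X - C (ξ i))).eval x
        * (derivative (derivative (C c * ∏ i ∈ s, (X - C (ξ i))))).eval x := by
  classical
  induction s using Finset.induction_on with
  | empty => simp
  | insert i s hi ih =>
    rw [Finset.prod_insert hi, mul_left_comm, sq_derivative_sub_X_sub_C_mul]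
    positivity

open Polynomial in
/-- A solution of `(1 - x²) u'' = -l u` that is a polynomial with simple real roots has its roots
separated from a root `b` by at least `√(3 (1 - b²) / l)`. -/
theorem three_mul_le_sq_sub_of_root {l b r : ℝ} {m : ℝ[X]} (hm : m.eval b ≠ 0)
    (hmL : 0 ≤ ((derivative m).eval b) ^ 2 - m.eval b * (derivative (derivative m)).eval b)
    (hode : (1 - X ^ 2) * derivative (derivative ((X - C b) * ((X - C r) * m)))
      = -C l * ((X - C b) * ((X - C r) * m)))
    (hb : 0 < 1 - b ^ 2) :
    3 * (1 - b ^ 2) ≤ l * (b - r) ^ 2 := by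
  have hL := sq_derivative_sub_X_sub_C_mul m r b
  have hg : ((X - C r) * m).eval b = (b - r) * m.eval b := by simp
  generalize (X - C r) * m = g at *
  have e0 := congrArg (eval b) hode
  have e1 := congrArg (eval b) (congrArg derivative hode)
  simp at e0 e1
  have h0 : (derivative g).eval b = 0 := e0.resolve_left hb.ne'
  rw [h0] at e1 hL
  have hm2 : 0 < (m.eval b) ^ 2 := by positivity
  have h3 : 3 * (1 - b ^ 2) * (m.eval b) ^ 2 ≤ l * (b - r) ^ 2 * (m.eval b) ^ 2 := by
    have hk : (m.eval b) ^ 2 ≤ -(g.eval b * (derivative (derivative g)).eval b) := by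
      nlinarith [mul_nonneg (sq_nonneg (b - r)) hmL]
    have e2 : 3 * (1 - b ^ 2) * (derivative (derivative g)).eval b = -l * g.eval b := by
      linarith
    calc 3 * (1 - b ^ 2) * (m.eval b) ^ 2
        ≤ 3 * (1 - b ^ 2) * -(g.eval b * (derivative (derivative g)).eval b) := by gcongr
      _ = l * g.eval b ^ 2 := by linear_combination (-g.eval b) * e2
      _ = _ := by rw [hg]; ring
  exact le_of_mul_le_mul_right h3 hm2

open Polynomial Real in
/-- Sturm comparison with `sin` for a positive arch of a solution of `(1 - x²) u'' = -l u`. -/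
theorem sturm_sq_sub_le_of_pos {l b c : ℝ} {u : ℝ[X]} (hbc : b < c) (hb : -1 ≤ b)
    (hc : c ≤ 1) (hode : (1 - X ^ 2) * derivative (derivative u) = -C l * u)
    (hub : u.eval b = 0) (huc : u.eval c = 0) (hpos : ∀ x ∈ Set.Ioo b c, 0 < u.eval x) :
    l * (c - b) ^ 2 ≤ π ^ 2 * ((1 + c) * (1 - b)) := by
  by_contra! hlt
  have hh : 0 < c - b := sub_pos.2 hbc
  set w := π / (c - b) with hw
  have hwc : w * (c - b) = π := by rw [hw]; field_simp
  have hderiv : ∀ x, HasDerivAt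
      (fun x ↦ (derivative u).eval x * sin (w * (x - b)) - u.eval x * (w * cos (w * (x - b))))
      (((derivative (derivative u)).eval x + w ^ 2 * u.eval x) * sin (w * (x - b))) x := by
    intro x
    have hlin : HasDerivAt (fun x ↦ w * (x - b)) w x := by
      simpa using ((hasDerivAt_id x).sub_const b).const_mul w
    have h := (((derivative u).hasDerivAt x).mul hlin.sin).sub
      ((u.hasDerivAt x).mul (hlin.cos.const_mul w))
    refine h.congr_deriv ?_
    ring
  have hanti := strictAntiOn_of_deriv_neg (convex_Icc b c)
    (fun x _ ↦ (hderiv x).continuousAt.continuousWithinAt) (fun x hx ↦ by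
      rw [interior_Icc] at hx
      have hx1 : 0 < 1 - x ^ 2 := by nlinarith [hx.1, hx.2]
      have hx2 : 1 - x ^ 2 ≤ (1 + c) * (1 - b) := by nlinarith [hx.1, hx.2]
      have hsin : 0 < sin (w * (x - b)) := by
        have hw0 : 0 < w := by positivity
        refine sin_pos_of_pos_of_lt_pi (mul_pos hw0 (sub_pos.2 hx.1)) ?_
        rw [← hwc]
        exact mul_lt_mul_of_pos_left (by linarith [hx.2]) hw0
      have he := congrArg (eval x) hode
      simp at he
      have hu := hpos x hx
      rw [(hderiv x).deriv]
      refine mul_neg_of_neg_of_pos ?_ hsin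
      have hwl : w ^ 2 * (1 - x ^ 2) < l := by
        rw [hw, div_pow, div_mul_eq_mul_div, div_lt_iff₀ (by positivity)]
        exact lt_of_le_of_lt (by gcongr) hlt
      have : (1 - x ^ 2) * ((derivative (derivative u)).eval x + w ^ 2 * u.eval x) < 0 := by
        nlinarith
      exact neg_of_mul_neg_right this hx1.le)
  have := hanti (Set.left_mem_Icc.2 hbc.le) (Set.right_mem_Icc.2 hbc.le) hbc
  simp [hub, huc, hwc] at this

open Polynomial Real in
/-- Upper bound on the distance of two consecutive zeros of a solution of `(1 - x²) u'' = -l u`. -/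
theorem sturm_sq_sub_le {l b c : ℝ} {u : ℝ[X]} (hbc : b < c) (hb : -1 ≤ b)
    (hc : c ≤ 1) (hode : (1 - X ^ 2) * derivative (derivative u) = -C l * u)
    (hub : u.eval b = 0) (huc : u.eval c = 0) (hne : ∀ x ∈ Set.Ioo b c, u.eval x ≠ 0) :
    l * (c - b) ^ 2 ≤ π ^ 2 * ((1 + c) * (1 - b)) := by
  have hcont : ContinuousOn (fun x ↦ u.eval x) (Set.Ioo b c) := u.continuous.continuousOn
  have hsign : (∀ x ∈ Set.Ioo b c, 0 < u.eval x) ∨ ∀ x ∈ Set.Ioo b c, u.eval x < 0 := by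
    by_contra! h
    obtain ⟨⟨x, hx, hx0⟩, y, hy, hy0⟩ := h
    obtain ⟨z, hz, hz0⟩ := isPreconnected_Ioo.intermediate_value hx hy hcont ⟨hx0, hy0⟩
    exact hne z hz hz0
  rcases hsign with h | h
  · exact sturm_sq_sub_le_of_pos hbc hb hc hode hub huc h
  · refine sturm_sq_sub_le_of_pos (u := -u) hbc hb hc ?_ (by simpa) (by simpa)
      (by simpa using fun x h1 h2 ↦ h x ⟨h1, h2⟩)
    simp only [derivative_neg]
    linear_combination -hode

theorem le_five_mul_of_sq_le {l P t w g h : ℝ} (hl : 0 < l) (hP : P ≤ 10) (ht : 0 < t)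
    (hw : 0 < w) (hg : 0 < g) (hh : 0 < h) (h1 : 3 * (t * w) ≤ l * g ^ 2)
    (h2 : 3 * (t * w) ≤ l * t ^ 2) (h3 : l * h ^ 2 ≤ P * ((t + h) * w)) : h ≤ 5 * g := by
  have h2' : 3 * w ≤ l * t := le_of_mul_le_mul_left (by linarith) ht
  have h3' : l * h ^ 2 ≤ 10 * ((t + h) * w) := h3.trans (by gcongr)
  have hs : h ≤ 5 * t := by
    have : l * (3 * h ^ 2) ≤ l * (10 * (t + h) * t) := by nlinarith [mul_pos (add_pos ht hh) hw]
    have := le_of_mul_le_mul_left this hl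
    nlinarith
  have : l * h ^ 2 ≤ l * (20 * g ^ 2) := by nlinarith
  have := le_of_mul_le_mul_left this hl
  nlinarith

open Polynomial in
theorem IsLGLNodes.exists_lglPoly_eq {N : ℕ} (hN : 1 ≤ N) {ξ : ℕ → ℝ} (hξ : IsLGLNodes N ξ) :
    ∃ c : ℝ, c ≠ 0 ∧ lglPoly N = C c * ∏ i ∈ Finset.range (N + 1), (X - C (ξ i)) := by
  obtain ⟨hmono, -, hlast, hroot, hall⟩ := hξ
  have hne : lglPoly N ≠ 0 := by
    intro h
    obtain ⟨k, hk, hk2⟩ := hall 2 (by simp [h])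
    have := hmono.monotoneOn (Set.mem_Iic.2 hk) (Set.mem_Iic.2 le_rfl) hk
    linarith
  have hdvd : ∏ i ∈ Finset.range (N + 1), (X - C (ξ i)) ∣ lglPoly N := by
    refine Finset.prod_dvd_of_coprime (fun i hi j hj hij ↦ ?_) (fun i hi ↦ ?_)
    · refine isCoprime_X_sub_C_of_isUnit_sub (sub_ne_zero.2 fun h ↦ hij ?_).isUnit
      refine hmono.injOn ?_ ?_ h
      · simpa [Nat.lt_succ_iff] using hi
      · simpa [Nat.lt_succ_iff] using hj
    · exact dvd_iff_isRoot.2 (hroot i (Nat.lt_succ_iff.1 (Finset.mem_range.1 hi)))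
  obtain ⟨q, hq⟩ := hdvd
  have hq0 : q ≠ 0 := by rintro rfl; simp [hq] at hne
  have hmonic : (∏ i ∈ Finset.range (N + 1), (X - C (ξ i))).Monic :=
    monic_prod_of_monic _ _ fun i _ ↦ monic_X_sub_C _
  have hdeg := natDegree_lglPoly_le hN
  rw [hq, hmonic.natDegree_mul' hq0, natDegree_prod_of_monic _ _ fun i _ ↦ monic_X_sub_C _] at hdeg
  simp at hdeg
  obtain ⟨c, rfl⟩ := natDegree_eq_zero.1 hdeg
  exact ⟨c, by simpa using hq0, by rw [hq, mul_comm]⟩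

theorem IsLGLNodes.abs_lt_one {N : ℕ} {ξ : ℕ → ℝ} (hξ : IsLGLNodes N ξ) {k : ℕ} (hk0 : 0 < k)
    (hkN : k < N) : -1 < ξ k ∧ ξ k < 1 := by
  obtain ⟨hmono, h0, hlast, -⟩ := hξ
  constructor
  · exact h0 ▸ hmono (Set.mem_Iic.2 (Nat.zero_le N)) (Set.mem_Iic.2 hkN.le) hk0
  · exact hlast ▸ hmono (Set.mem_Iic.2 hkN.le) (Set.mem_Iic.2 le_rfl) hkN

open Polynomial in
/-- Separation of an interior LGL node from every other node. -/
theorem IsLGLNodes.three_mul_le_sq_sub {N : ℕ} {ξ : ℕ → ℝ} (hξ : IsLGLNodes N ξ) {k i : ℕ}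
    (hk0 : 0 < k) (hkN : k < N) (hi : i ≤ N) (hik : i ≠ k) :
    3 * (1 - ξ k ^ 2) ≤ N * (N + 1) * (ξ k - ξ i) ^ 2 := by
  obtain ⟨c, hc, hp⟩ := hξ.exists_lglPoly_eq (by omega)
  have hb := hξ.abs_lt_one hk0 hkN
  have hprod : lglPoly N = (X - C (ξ k)) * ((X - C (ξ i)) *
      (C c * ∏ j ∈ ((Finset.range (N + 1)).erase k).erase i, (X - C (ξ j)))) := by
    rw [hp, ← Finset.mul_prod_erase (Finset.range (N + 1)) _ (Finset.mem_range.2 (by omega)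
      : k ∈ Finset.range (N + 1)), ← Finset.mul_prod_erase ((Finset.range (N + 1)).erase k) _
      (by simp; omega : i ∈ (Finset.range (N + 1)).erase k)]
    ring
  refine three_mul_le_sq_sub_of_root ?_ (laguerre_inequality c ξ _ (ξ k)) (hprod ▸ lglPoly_ode N)
    (by nlinarith)
  simp only [eval_mul, eval_C, eval_prod, eval_sub, eval_X]
  refine mul_ne_zero hc (Finset.prod_ne_zero_iff.2 fun j hj ↦ sub_ne_zero.2 fun h ↦ ?_)
  simp only [Finset.mem_erase, Finset.mem_range] at hj
  exact hj.2.1 (hξ.1.injOn (Set.mem_Iic.2 hkN.le) (Set.mem_Iic.2 (by omega)) h).symm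

open Real in
/-- Upper bound on the length of an LGL interval. -/
theorem IsLGLNodes.sq_sub_le {N : ℕ} {ξ : ℕ → ℝ} (hξ : IsLGLNodes N ξ) {k : ℕ} (hk : k < N) :
    N * (N + 1) * (ξ (k + 1) - ξ k) ^ 2 ≤ π ^ 2 * ((1 + ξ (k + 1)) * (1 - ξ k)) := by
  obtain ⟨hmono, h0, hlast, hroot, hall⟩ := hξ
  refine sturm_sq_sub_le (hmono hk.le hk (Nat.lt_succ_self k)) ?_ ?_
    (lglPoly_ode N) (hroot k hk.le) (hroot (k + 1) hk) fun x hx hx0 ↦ ?_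
  · exact h0 ▸ hmono.monotoneOn (Nat.zero_le N) hk.le (Nat.zero_le k)
  · exact hlast ▸ hmono.monotoneOn hk (Set.mem_Iic.2 le_rfl) hk
  · obtain ⟨j, hj, rfl⟩ := hall x hx0
    have h1 := (hmono.lt_iff_lt hk.le hj).1 hx.1
    have h2 := (hmono.lt_iff_lt hj hk).1 hx.2
    omega

open Real in
/-- Quasi-uniformity of LGL grids: for `N ≥ 2` and `1 ≤ k ≤ N-1`,
`4/(7π²) ≤ |Δ_k^N|/|Δ_{k-1}^N| ≤ 7π²/4`. -/
theorem lgl_quasi_uniformity (N : ℕ) (hN : 2 ≤ N) (ξ : ℕ → ℝ)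
    (hξ : IsLGLNodes N ξ) (k : ℕ) (hk1 : 1 ≤ k) (hk2 : k ≤ N - 1) :
    4 / (7 * π ^ 2) ≤ (ξ (k + 1) - ξ k) / (ξ k - ξ (k - 1)) ∧
    (ξ (k + 1) - ξ k) / (ξ k - ξ (k - 1)) ≤ 7 * π ^ 2 / 4 := by
  obtain ⟨j, rfl⟩ : ∃ j, k = j + 1 := ⟨k - 1, by omega⟩
  have hk0 : 0 < j + 1 := hk1
  have hkN : j + 1 < N := by omega
  rw [Nat.add_sub_cancel]
  have hN0 : (0 : ℝ) < N := by exact_mod_cast (by omega : 0 < N)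
  have hl : (0 : ℝ) < N * (N + 1) := by positivity
  have hpi9 : 9 < π ^ 2 := by nlinarith [pi_gt_three]
  have hpi10 : π ^ 2 ≤ 10 := by nlinarith [pi_gt_three, pi_lt_d2]
  have hb := hξ.abs_lt_one hk0 hkN
  have hg : 0 < ξ (j + 1) - ξ j :=
    sub_pos.2 (hξ.1 (Set.mem_Iic.2 (by omega)) (Set.mem_Iic.2 hkN.le) (Nat.lt_succ_self j))
  have hh : 0 < ξ (j + 1 + 1) - ξ (j + 1) :=
    sub_pos.2 (hξ.1 (Set.mem_Iic.2 hkN.le) (Set.mem_Iic.2 hkN) (Nat.lt_succ_self _))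
  have hleft := hξ.three_mul_le_sq_sub hk0 hkN (i := j) (by omega) (by omega)
  have hright := hξ.three_mul_le_sq_sub hk0 hkN (i := j + 1 + 1) hkN (by omega)
  have hfirst := hξ.three_mul_le_sq_sub hk0 hkN (i := 0) (by omega) (by omega)
  have hlast := hξ.three_mul_le_sq_sub hk0 hkN (i := N) le_rfl hkN.ne'
  have hupR := hξ.sq_sub_le hkN
  have hupL := hξ.sq_sub_le (k := j) (by omega)
  rw [hξ.2.1] at hfirst
  rw [hξ.2.2.1] at hlast
  have hup : ξ (j + 1 + 1) - ξ (j + 1) ≤ 5 * (ξ (j + 1) - ξ j) :=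
    le_five_mul_of_sq_le (t := 1 + ξ (j + 1)) (w := 1 - ξ (j + 1)) hl hpi10 (by linarith)
      (by linarith) hg hh (by linarith) (by linarith) (hupR.trans_eq (by ring))
  have hlow : ξ (j + 1) - ξ j ≤ 5 * (ξ (j + 1 + 1) - ξ (j + 1)) :=
    le_five_mul_of_sq_le (t := 1 - ξ (j + 1)) (w := 1 + ξ (j + 1)) hl hpi10 (by linarith)
      (by linarith) hh hg (by linarith) (by linarith) (hupL.trans_eq (by ring))
  constructor
  · rw [div_le_div_iff₀ (by positivity) hg]
    nlinarith
  · rw [div_le_iff₀ hg]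
    nlinarith
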